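/- Let μ : [-1,0] → L(ℂⁿ)₊ be a positive operator-valued function of bounded variation with μ(0) = 0, and consider the hyperbolic system with delayed boundary condition y(0,t) = ∫₀¹ ∫_{-1}^0 dμ(θ) y(x, t+θ) dx. If the total variation satisfies |μ|([-1,0]) < 1, then the associated closed-loop semigroup on 𝒳 × L²([-1,0], 𝒳) is uniformly exponentially stable. -/

import Mathlib

open Filter MeasureTheory Set

attribute [local instance] Matrix.linftyOpNormedAddCommGroup

/-- Lebesgue measure on `[0,1]` (the space variable `x`). -/
noncomputable def mu01 : Measure ℝ := volume.restrict (Icc (0 : ℝ) 1)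

/-- Lebesgue measure on `[-1,0] × [0,1]` (the variables `(θ, x)`). -/
noncomputable def muDelay : Measure (ℝ × ℝ) :=
  (volume.restrict (Icc (-1 : ℝ) 0)).prod mu01

/-- The state space `𝔛 = 𝒳 × L²([-1,0], 𝒳)` with `𝒳 = L²([0,1], ℝⁿ)`. -/
abbrev DelayState (n : ℕ) :=
  Lp (α := ℝ) (Fin n → ℝ) 2 mu01 × Lp (α := ℝ × ℝ) (Fin n → ℝ) 2 muDelay

/-- `DelayGen d ν z w` says `z ∈ D(𝔄^{cl})` and `𝔄^{cl} z = w` for the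
closed-loop generator of the hyperbolic system with delayed boundary condition
`y(0,t) = ∫₀¹ ∫_{-1}^0 dμ(θ) y(x, t+θ) dx` (the entries of `dμ` being the
measures `ν i j`): `z = (f, φ)` with `f ∈ (H¹[0,1])ⁿ`, `φ` absolutely
continuous in `θ` with square-integrable `∂_θ φ`, matching condition
`φ(·, 0) = f`, boundary condition `f(0) = ∫₀¹∫_{-1}^0 dμ(θ) φ(x,θ) dx`, and
`𝔄^{cl}(f, φ) = (-D f', ∂_θ φ)`. -/
def DelayGen {n : ℕ} (d : Fin n → ℝ) (ν : Fin n → Fin n → Measure ℝ)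
    (z w : DelayState n) : Prop :=
  ∃ F G : ℝ → Fin n → ℝ, ∃ Φ Ψ : ℝ × ℝ → Fin n → ℝ,
    (z.1 : ℝ → Fin n → ℝ) =ᵐ[mu01] F ∧ (w.1 : ℝ → Fin n → ℝ) =ᵐ[mu01] G ∧
    (z.2 : ℝ × ℝ → Fin n → ℝ) =ᵐ[muDelay] Φ ∧
    (w.2 : ℝ × ℝ → Fin n → ℝ) =ᵐ[muDelay] Ψ ∧
    -- `w.1 = -D F'`:
    (∀ i : Fin n, ∀ x ∈ Icc (0 : ℝ) 1,
      F x i = F 0 i + ∫ s in (0 : ℝ)..x, -(d i)⁻¹ * G s i) ∧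
    -- `w.2 = ∂_θ Φ`:
    (∀ x ∈ Icc (0 : ℝ) 1, ∀ i : Fin n, ∀ θ ∈ Icc (-1 : ℝ) 0,
      Φ (θ, x) i = Φ (-1, x) i + ∫ τ in (-1 : ℝ)..θ, Ψ (τ, x) i) ∧
    -- matching condition `φ(x, 0) = f(x)`:
    (∀ x ∈ Icc (0 : ℝ) 1, ∀ i : Fin n, Φ (0, x) i = F x i) ∧
    -- delayed boundary condition `f(0) = ∫₀¹ ∫_{-1}^0 dμ(θ) φ(x, θ) dx`:
    (∀ i : Fin n, F 0 i = ∑ j : Fin n, ∫ θ, (∫ x, Φ (θ, x) j ∂mu01) ∂(ν i j))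

section Semigroup

variable {E : Type*} [NormedAddCommGroup E] [NormedSpace ℝ E] {T : ℝ → E →L[ℝ] E}

/-- Orbits of a semigroup through its domain are right differentiable. -/
lemma semigroup_tendsto_slope
    (hTadd : ∀ t s : ℝ, 0 ≤ t → 0 ≤ s → T (t + s) = (T t).comp (T s)) {z w : E}
    (hzw : Tendsto (fun t : ℝ => t⁻¹ • (T t z - z)) (nhdsWithin 0 (Ioi 0)) (nhds w))
    {t : ℝ} (ht : 0 ≤ t) :
    Tendsto (fun h : ℝ => h⁻¹ • (T h (T t z) - T t z)) (nhdsWithin 0 (Ioi 0)) (nhds (T t w)) := by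
  refine (((T t).continuous.tendsto w).comp hzw).congr' ?_
  filter_upwards [self_mem_nhdsWithin] with h hh
  have hh : 0 ≤ h := le_of_lt hh
  have : T h (T t z) = T t (T h z) := by
    rw [← ContinuousLinearMap.comp_apply, ← ContinuousLinearMap.comp_apply, ← hTadd h t hh ht,
      ← hTadd t h ht hh, add_comm]
  simp [this]

lemma semigroup_hasDerivWithinAt
    (hTadd : ∀ t s : ℝ, 0 ≤ t → 0 ≤ s → T (t + s) = (T t).comp (T s)) {z w : E}
    (hzw : Tendsto (fun t : ℝ => t⁻¹ • (T t z - z)) (nhdsWithin 0 (Ioi 0)) (nhds w))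
    {t : ℝ} (ht : 0 ≤ t) :
    HasDerivWithinAt (fun s => T s z) (T t w) (Ici t) t := by
  rw [← hasDerivWithinAt_Ioi_iff_Ici, hasDerivWithinAt_iff_tendsto_slope' (by simp)]
  have hsub : Tendsto (fun s => s - t) (nhdsWithin t (Ioi t)) (nhdsWithin 0 (Ioi 0)) := by
    refine tendsto_nhdsWithin_iff.2 ⟨?_, ?_⟩
    · have : Tendsto (fun s => s - t) (nhds t) (nhds (t - t)) :=
        (continuous_id.sub continuous_const).tendsto t
      rw [sub_self] at this
      exact this.mono_left nhdsWithin_le_nhds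
    · filter_upwards [self_mem_nhdsWithin] with s hs
      exact mem_Ioi.2 (sub_pos.2 (mem_Ioi.1 hs))
  refine ((semigroup_tendsto_slope hTadd hzw ht).comp hsub).congr' ?_
  filter_upwards [self_mem_nhdsWithin] with s hs
  have hs : 0 ≤ s - t := (sub_pos.2 (mem_Ioi.1 hs)).le
  have h1 := hTadd (s - t) t hs ht
  rw [sub_add_cancel] at h1
  simp [slope, h1]

/-- Time averages of an orbit of a strongly continuous semigroup lie in the domain of the
generator. -/
lemma semigroup_tendsto_average [CompleteSpace E]
    (hTadd : ∀ t s : ℝ, 0 ≤ t → 0 ≤ s → T (t + s) = (T t).comp (T s))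
    (hTcont : ∀ z : E, ContinuousOn (fun t => T t z) (Ici (0 : ℝ))) (z : E) {h : ℝ} (hh : 0 < h) :
    Tendsto (fun t : ℝ => t⁻¹ • (T t (∫ s in (0 : ℝ)..h, T s z) - ∫ s in (0 : ℝ)..h, T s z))
      (nhdsWithin 0 (Ioi 0)) (nhds (T h z - T 0 z)) := by
  set u : ℝ → E := fun s => T (max s 0) z with hu
  have hucont : Continuous u :=
    (hTcont z).comp_continuous (continuous_id.max continuous_const) (fun s => mem_Ici.2 (le_max_right _ _))
  have hueq : ∀ s, 0 ≤ s → u s = T s z := fun s hs => by simp [hu, max_eq_left hs]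
  have hint : ∀ a b : ℝ, IntervalIntegrable u volume a b := fun a b => hucont.intervalIntegrable a b
  have hav : ∫ s in (0 : ℝ)..h, T s z = ∫ s in (0 : ℝ)..h, u s := by
    refine intervalIntegral.integral_congr fun s hs => ?_
    rw [uIcc_of_le hh.le] at hs
    exact (hueq s hs.1).symm
  have hder : ∀ a : ℝ, Tendsto (fun t : ℝ => t⁻¹ • ∫ s in a..a + t, u s)
      (nhdsWithin 0 (Ioi 0)) (nhds (u a)) := by
    intro a
    have h1 : HasDerivAt (fun x => ∫ s in a..x, u s) (u a) a :=
      intervalIntegral.integral_hasDerivAt_right (hint a a)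
        hucont.aestronglyMeasurable.stronglyMeasurableAtFilter hucont.continuousAt
    have h2 := h1.tendsto_slope_zero_right
    simpa using h2
  have key := (hder h).sub (hder 0)
  rw [hueq h hh.le, hueq 0 le_rfl] at key
  refine key.congr' ?_
  filter_upwards [self_mem_nhdsWithin] with t ht
  have ht : (0 : ℝ) < t := ht
  have hTt : T t (∫ s in (0 : ℝ)..h, u s) = ∫ s in t..t + h, u s := by
    rw [← ContinuousLinearMap.intervalIntegral_comp_comm _ (hint 0 h)]
    have : ∫ s in t..t + h, u s = ∫ s in (0 : ℝ)..h, u (t + s) := by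
      rw [intervalIntegral.integral_comp_add_left]; simp
    rw [this]
    refine intervalIntegral.integral_congr fun s hs => ?_
    rw [uIcc_of_le hh.le] at hs
    rw [hueq s hs.1, hueq (t + s) (add_nonneg ht.le hs.1), hTadd t s ht.le hs.1]
    rfl
  rw [hav, hTt, ← smul_sub]
  congr 1
  rw [zero_add, add_comm h t, ← intervalIntegral.integral_add_adjacent_intervals (hint 0 t) (hint t h),
    ← intervalIntegral.integral_add_adjacent_intervals (hint t h) (hint h (t + h))]
  abel

/-- The domain of the generator of a strongly continuous semigroup is dense. -/
lemma semigroup_dense_domain [CompleteSpace E] (hT0 : T 0 = 1)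
    (hTadd : ∀ t s : ℝ, 0 ≤ t → 0 ≤ s → T (t + s) = (T t).comp (T s))
    (hTcont : ∀ z : E, ContinuousOn (fun t => T t z) (Ici (0 : ℝ))) :
    Dense {z : E | ∃ w,
      Tendsto (fun t : ℝ => t⁻¹ • (T t z - z)) (nhdsWithin 0 (Ioi 0)) (nhds w)} := by
  intro z
  set u : ℝ → E := fun s => T (max s 0) z with hu
  have hucont : Continuous u :=
    (hTcont z).comp_continuous (continuous_id.max continuous_const) (fun s => mem_Ici.2 (le_max_right _ _))
  have h1 : HasDerivAt (fun x => ∫ s in (0 : ℝ)..x, u s) (u 0) 0 :=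
    intervalIntegral.integral_hasDerivAt_right (hucont.intervalIntegrable 0 0)
      hucont.aestronglyMeasurable.stronglyMeasurableAtFilter hucont.continuousAt
  have h2 := h1.tendsto_slope_zero_right
  have hu0 : u 0 = z := by simp [hu, hT0]
  simp only [zero_add, intervalIntegral.integral_same, sub_zero, hu0] at h2
  refine mem_closure_of_tendsto h2 ?_
  filter_upwards [self_mem_nhdsWithin] with h hh
  have hh : (0 : ℝ) < h := hh
  have hav : ∫ s in (0 : ℝ)..h, T s z = ∫ s in (0 : ℝ)..h, u s := by
    refine intervalIntegral.integral_congr fun s hs => ?_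
    rw [uIcc_of_le hh.le] at hs
    simp [hu, max_eq_left hs.1]
  refine ⟨h⁻¹ • (T h z - T 0 z), ?_⟩
  have := (semigroup_tendsto_average hTadd hTcont z hh).const_smul h⁻¹
  rw [hav] at this
  refine this.congr fun t => ?_
  rw [map_smul, ← smul_sub, smul_comm]

/-- A coercive bounded quadratic Lyapunov functional that dissipates along the generator yields
uniform exponential stability. -/
theorem exponentially_stable_of_quadratic_lyapunov [CompleteSpace E] (hT0 : T 0 = 1)
    (hTadd : ∀ t s : ℝ, 0 ≤ t → 0 ≤ s → T (t + s) = (T t).comp (T s))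
    (hTcont : ∀ z : E, ContinuousOn (fun t => T t z) (Ici (0 : ℝ)))
    (B : E →L[ℝ] E →L[ℝ] ℝ) {a ε : ℝ} (ha : 0 < a) (hε : 0 < ε)
    (hcoer : ∀ z, a * ‖z‖ ^ 2 ≤ B z z)
    (hdiss : ∀ z w, Tendsto (fun t : ℝ => t⁻¹ • (T t z - z)) (nhdsWithin 0 (Ioi 0)) (nhds w) →
      B z w + B w z ≤ -ε * ‖z‖ ^ 2) :
    ∃ M ω : ℝ, 0 < M ∧ ω < 0 ∧ ∀ t : ℝ, 0 ≤ t → ‖T t‖ ≤ M * Real.exp (ω * t) := by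
  set C := ‖B‖ + 1 with hC
  have hCpos : 0 < C := by positivity
  have hBC : ∀ z, B z z ≤ C * ‖z‖ ^ 2 := fun z => by
    have := (le_abs_self _).trans (B.le_opNorm₂ z z)
    nlinarith [sq_nonneg ‖z‖]
  set δ := ε / C with hδ
  have hδpos : 0 < δ := by positivity
  have hdom : ∀ z ∈ {z : E | ∃ w,
      Tendsto (fun t : ℝ => t⁻¹ • (T t z - z)) (nhdsWithin 0 (Ioi 0)) (nhds w)},
      ∀ t, 0 ≤ t → B (T t z) (T t z) ≤ B z z * Real.exp (-δ * t) := by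
    rintro z ⟨w, hzw⟩ t ht
    have hder : ∀ x ∈ Ico 0 t, HasDerivWithinAt (fun s => B (T s z) (T s z))
        (B (T x z) (T x w) + B (T x w) (T x z)) (Ici x) x := fun x hx => by
      have h1 := semigroup_hasDerivWithinAt hTadd hzw hx.1
      exact B.hasDerivWithinAt_of_bilinear h1 h1
    have hcont : ContinuousOn (fun s => B (T s z) (T s z)) (Icc 0 t) := by
      have h1 : ContinuousOn (fun s => T s z) (Icc 0 t) := (hTcont z).mono fun s hs => hs.1
      exact (B.continuous.comp_continuousOn h1).clm_apply h1
    have := le_gronwallBound_of_liminf_deriv_right_le (K := -δ) (ε := 0) (δ := B z z) hcont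
      (fun x hx r hr => by
        simpa [slope_def_field, div_eq_inv_mul] using (hder x hx).liminf_right_slope_le hr)
      (by simp [hT0])
      (fun x hx => by
        have h1 := hdiss _ _ (semigroup_tendsto_slope hTadd hzw hx.1)
        have h2 : δ * B (T x z) (T x z) ≤ ε * ‖T x z‖ ^ 2 := by
          calc δ * B (T x z) (T x z) ≤ δ * (C * ‖T x z‖ ^ 2) := by gcongr; exact hBC _
            _ = ε * ‖T x z‖ ^ 2 := by rw [hδ]; field_simp
        linarith) t ⟨ht, le_rfl⟩
    rw [gronwallBound_of_K_ne_0 (by linarith)] at this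
    simpa using this
  have hall : ∀ t, 0 ≤ t → ∀ z, B (T t z) (T t z) ≤ B z z * Real.exp (-δ * t) := by
    intro t ht z
    have hclosed : IsClosed {z : E | B (T t z) (T t z) ≤ B z z * Real.exp (-δ * t)} := by
      apply isClosed_le <;> fun_prop
    exact hclosed.closure_subset_iff.2 (fun z hz => hdom z hz t ht)
      (semigroup_dense_domain hT0 hTadd hTcont z)
  refine ⟨Real.sqrt (C / a), -δ / 2, by positivity, by linarith, fun t ht => ?_⟩
  refine ContinuousLinearMap.opNorm_le_bound _ (by positivity) fun z => ?_
  refine le_of_sq_le_sq ?_ (by positivity)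
  have hexp : Real.exp (-δ / 2 * t) ^ 2 = Real.exp (-δ * t) := by
    rw [← Real.exp_nat_mul]; congr 1; push_cast; ring
  rw [mul_pow, mul_pow, Real.sq_sqrt (by positivity), hexp]
  have h1 : a * ‖T t z‖ ^ 2 ≤ C * ‖z‖ ^ 2 * Real.exp (-δ * t) :=
    (hcoer _).trans ((hall t ht z).trans (by gcongr; exact hBC z))
  rw [div_mul_eq_mul_div, div_mul_eq_mul_div, le_div_iff₀ ha]
  linarith

end Semigroup

/-- Cauchy-Schwarz for the integral of a square-integrable function on a finite measure space. -/
lemma sq_integral_le_measure_mul_integral_sq {α : Type*} [MeasurableSpace α] {μ : Measure α}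
    [IsFiniteMeasure μ] {g : α → ℝ} (hg : MemLp g 2 μ) :
    (∫ x, g x ∂μ) ^ 2 ≤ μ.real univ * ∫ x, g x ^ 2 ∂μ := by
  have hg1 : Integrable g μ := hg.integrable (by norm_num)
  have hg2 : Integrable (fun x => g x ^ 2) μ := hg.integrable_sq
  set m := μ.real univ with hm
  set I := ∫ x, g x ∂μ with hI
  have hm0 : 0 ≤ m := measureReal_nonneg
  rcases hm0.eq_or_lt with h0 | h0
  · have : μ = 0 := by
      rw [← Measure.measure_univ_eq_zero]
      exact (measureReal_eq_zero_iff).1 h0.symm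
    simp [hI, this]
  · have h1 : ∫ x, (m * g x - I) ^ 2 ∂μ = m ^ 2 * (∫ x, g x ^ 2 ∂μ) - 2 * m * I * I + I ^ 2 * m := by
      have h2 : (fun x => (m * g x - I) ^ 2) =
          fun x => (m ^ 2 * g x ^ 2 - 2 * m * I * g x) + I ^ 2 := by
        funext x; ring
      have h3 : Integrable (fun x => m ^ 2 * g x ^ 2 - 2 * m * I * g x) μ :=
        (hg2.const_mul _).sub (hg1.const_mul _)
      rw [h2, integral_add h3 (integrable_const _),
        integral_sub (hg2.const_mul _) (hg1.const_mul _), integral_const_mul, integral_const_mul,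
        integral_const, ← hI, ← hm, smul_eq_mul, mul_comm m (I ^ 2)]
    have h3 : 0 ≤ ∫ x, (m * g x - I) ^ 2 ∂μ := integral_nonneg fun x => sq_nonneg _
    rw [h1] at h3
    nlinarith [show m * (m * (∫ x, g x ^ 2 ∂μ) - I ^ 2) ≥ 0 by nlinarith]

/-- The diagonal weighted `L²` form with bounded weights is a bounded bilinear form. -/
lemma exists_weighted_form {α : Type*} [MeasurableSpace α] {μ : Measure α} {n : ℕ}
    (k : Fin n → α → ℝ) (hk : ∀ j, MemLp (k j) ⊤ μ) :
    ∃ W : Lp (Fin n → ℝ) 2 μ →L[ℝ] Lp (Fin n → ℝ) 2 μ →L[ℝ] ℝ,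
      ∀ u v, W u v = ∑ j, ∫ x, k j x * (u x j * v x j) ∂μ := by
  let P (j : Fin n) : Lp (Fin n → ℝ) 2 μ →L[ℝ] Lp ℝ 2 μ :=
    (ContinuousLinearMap.proj (R := ℝ) (φ := fun _ : Fin n => ℝ) j).compLpL 2 μ
  let K (j : Fin n) : Lp ℝ 2 μ →L[ℝ] Lp ℝ 2 μ :=
    (ContinuousLinearMap.mul ℝ ℝ).holderL μ ⊤ 2 2 ((hk j).toLp (k j))
  refine ⟨∑ j, ((ContinuousLinearMap.mul ℝ ℝ).lpPairing μ 2 2).bilinearComp (K j ∘L P j) (P j),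
    fun u v => ?_⟩
  simp only [sum_apply, ContinuousLinearMap.bilinearComp_apply,
    ContinuousLinearMap.lpPairing_eq_integral]
  refine Finset.sum_congr rfl fun j _ => integral_congr_ae ?_
  have hP : ∀ u, P j u =ᵐ[μ] fun x => u x j := fun u =>
    (ContinuousLinearMap.proj (R := ℝ) (φ := fun _ : Fin n => ℝ) j).coeFn_compLpL u
  have hK : K j (P j u) =ᵐ[μ] fun x => ((hk j).toLp (k j)) x * P j u x :=
    (ContinuousLinearMap.mul ℝ ℝ).coeFn_holder _ _
  filter_upwards [hP u, hP v, hK, (hk j).coeFn_toLp] with x h1 h2 h3 h4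
  simp [h1, h2, h3, h4, mul_assoc]

lemma memLp_component {α : Type*} [MeasurableSpace α] {μ : Measure α} {n : ℕ}
    (u : Lp (Fin n → ℝ) 2 μ) (j : Fin n) : MemLp (fun x => u x j) 2 μ :=
  (ContinuousLinearMap.proj (R := ℝ) (φ := fun _ : Fin n => ℝ) j).comp_memLp' (Lp.memLp u)

lemma norm_sq_le_sum_integral_sq {α : Type*} [MeasurableSpace α] {μ : Measure α} {n : ℕ}
    (u : Lp (Fin n → ℝ) 2 μ) : ‖u‖ ^ 2 ≤ ∑ j, ∫ x, u x j ^ 2 ∂μ := by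
  have h1 : ‖u‖ ^ 2 = ∫ x, ‖u x‖ ^ 2 ∂μ := by
    rw [Lp.norm_def, (Lp.memLp u).eLpNorm_eq_integral_rpow_norm (by norm_num) (by norm_num),
      ENNReal.toReal_ofReal (by positivity), ← Real.rpow_natCast, ← Real.rpow_mul (by positivity)]
    simp
  rw [h1, ← integral_finsetSum _ fun j _ => (memLp_component u j).integrable_sq]
  refine integral_mono_of_nonneg (Eventually.of_forall fun x => by positivity)
    (integrable_finsetSum _ fun j _ => (memLp_component u j).integrable_sq)
    (Eventually.of_forall fun x => ?_)
  simp only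
  have hs : 0 ≤ ∑ j, u x j ^ 2 := Finset.sum_nonneg fun j _ => sq_nonneg _
  rw [← Real.le_sqrt (norm_nonneg _) hs, pi_norm_le_iff_of_nonneg (Real.sqrt_nonneg _)]
  intro j
  refine Real.le_sqrt_of_sq_le ?_
  rw [Real.norm_eq_abs, sq_abs]
  exact Finset.single_le_sum (f := fun j => u x j ^ 2) (fun j _ => sq_nonneg _) (Finset.mem_univ j)

lemma weighted_form_coercive {α : Type*} [MeasurableSpace α] {μ : Measure α} {n : ℕ}
    {k : Fin n → α → ℝ} (hk : ∀ j, MemLp (k j) ⊤ μ) {a : ℝ} (ha : 0 ≤ a)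
    (hak : ∀ j, ∀ᵐ x ∂μ, a ≤ k j x) (u : Lp (Fin n → ℝ) 2 μ) :
    a * ‖u‖ ^ 2 ≤ ∑ j, ∫ x, k j x * (u x j * u x j) ∂μ := by
  refine (mul_le_mul_of_nonneg_left (norm_sq_le_sum_integral_sq u) ha).trans ?_
  rw [Finset.mul_sum]
  refine Finset.sum_le_sum fun j _ => ?_
  rw [← integral_const_mul]
  have hu := (memLp_component u j).integrable_sq
  refine integral_mono_ae (hu.const_mul a) ?_ ?_
  · have := hu.mul_of_top_right (hk j)
    refine this.congr (Eventually.of_forall fun x => ?_)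
    simp [sq]
  · filter_upwards [hak j] with x hx
    rw [← sq]
    exact mul_le_mul_of_nonneg_right hx (sq_nonneg _)

/-- Fundamental theorem of calculus for the square of an absolutely continuous function. -/
lemma integral_two_mul_eq_sq_sub_sq {a b : ℝ} (hab : a ≤ b) {g H : ℝ → ℝ}
    (hg : IntervalIntegrable g volume a b)
    (hH : ∀ x ∈ Icc a b, H x = H a + ∫ s in a..x, g s) {σ : ℝ} (hσ : σ ∈ Icc a b) :
    ∫ x in σ..b, 2 * (H x * g x) = H b ^ 2 - H σ ^ 2 := by
  set J : ℝ → ℝ := fun x => H a + ∫ s in a..x, g s with hJ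
  have hac0 := hg.absolutelyContinuousOnInterval_intervalIntegral (c := a) (by simp)
  have hac : AbsolutelyContinuousOnInterval J a b := by
    have hconst : AbsolutelyContinuousOnInterval (fun _ : ℝ => H a) a b :=
      ContDiffOn.absolutelyContinuousOnInterval contDiffOn_const
    exact hconst.add hac0
  have hac' : AbsolutelyContinuousOnInterval J σ b :=
    hac.mono (by rw [uIcc_of_le hσ.2, uIcc_of_le hab]; exact Icc_subset_Icc_left hσ.1)
  have key := hac'.integral_deriv_mul_eq_sub hac'
  rw [hH b ⟨hab, le_rfl⟩, hH σ hσ, sq, sq]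
  refine Eq.trans (intervalIntegral.integral_congr_ae ?_) key
  filter_upwards [hg.ae_hasDerivAt_integral] with x hx hxm
  rw [uIoc_of_le hσ.2] at hxm
  have hxI : x ∈ Icc a b := ⟨hσ.1.trans hxm.1.le, hxm.2⟩
  have hd : deriv J x = g x :=
    ((hx (by rwa [uIcc_of_le hab]) a (by simp)).const_add (H a)).deriv
  rw [hd, hH x hxI]
  simp only [hJ]
  ring

/-- Integration by parts against the distribution function of a finite measure. -/
lemma integral_measureReal_Iic_mul_eq {a b : ℝ} (hab : a ≤ b) {g H : ℝ → ℝ}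
    (hg : IntegrableOn g (Icc a b)) (hH : ∀ x ∈ Icc a b, H x = H a + ∫ s in a..x, g s)
    (ρ : Measure ℝ) [IsFiniteMeasure ρ] (hρ : ρ (Icc a b)ᶜ = 0) :
    ∫ x in Icc a b, ρ.real (Iic x) * (2 * (H x * g x)) =
      ρ.real univ * H b ^ 2 - ∫ x, H x ^ 2 ∂ρ := by
  have hgi : IntervalIntegrable g volume a b :=
    (intervalIntegrable_iff_integrableOn_Icc_of_le hab).2 hg
  have hHc : ContinuousOn H (Icc a b) := by
    have h1 : ContinuousOn (fun x => H a + ∫ s in a..x, g s) (Icc a b) := by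
      have := intervalIntegral.continuousOn_primitive_interval' hgi (a := a) (by simp)
      rw [uIcc_of_le hab] at this
      exact continuousOn_const.add this
    exact h1.congr hH
  have hρae : ∀ᵐ x ∂ρ, x ∈ Icc a b := hρ
  have hρr : ρ.restrict (Icc a b) = ρ := Measure.restrict_eq_self_of_ae_mem hρae
  have hH2 : Integrable (fun x => H x ^ 2) ρ := by
    have : IntegrableOn (fun x => H x ^ 2) (Icc a b) ρ := (hHc.pow 2).integrableOn_compact isCompact_Icc
    rwa [IntegrableOn, hρr] at this
  have hq : Integrable (fun x => 2 * (H x * g x)) (volume.restrict (Icc a b)) := by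
    have : IntegrableOn (fun x => H x * g x) (Icc a b) := hg.continuousOn_mul hHc isCompact_Icc
    exact this.const_mul 2
  set q : ℝ → ℝ := fun x => 2 * (H x * g x) with hqdef
  have hset : MeasurableSet {p : ℝ × ℝ | p.2 ≤ p.1} := measurableSet_le measurable_snd measurable_fst
  have hint : Integrable (Function.uncurry fun x σ => (Iic x).indicator (fun _ => q x) σ)
      ((volume.restrict (Icc a b)).prod ρ) := by
    have := (hq.comp_fst ρ).indicator hset
    refine this.congr (Eventually.of_forall fun p => ?_)
    simp [Function.uncurry, indicator]
  calc ∫ x in Icc a b, ρ.real (Iic x) * q x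
      = ∫ x in Icc a b, ∫ σ, (Iic x).indicator (fun _ => q x) σ ∂ρ := by
        refine integral_congr_ae (Eventually.of_forall fun x => ?_)
        simp [integral_indicator measurableSet_Iic]
    _ = ∫ σ, (∫ x in Icc a b, (Iic x).indicator (fun _ => q x) σ) ∂ρ :=
        integral_integral_swap hint
    _ = ∫ σ, (H b ^ 2 - H σ ^ 2) ∂ρ := by
        refine integral_congr_ae ?_
        filter_upwards [hρae] with σ hσ
        rw [← integral_two_mul_eq_sq_sub_sq hab hgi hH hσ, intervalIntegral.integral_of_le hσ.2,
          ← integral_Icc_eq_integral_Ioc]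
        have h1 : (fun x => (Iic x).indicator (fun _ => q x) σ) = (Ici σ).indicator q := by
          funext x; simp [indicator]
        rw [h1, setIntegral_indicator measurableSet_Ici]
        have h2 : Icc a b ∩ Ici σ = Icc σ b := by
          ext x; simp only [mem_inter_iff, mem_Icc, mem_Ici]
          exact ⟨fun h => ⟨h.2, h.1.2⟩, fun h => ⟨⟨hσ.1.trans h.1, h.2⟩, h.1⟩⟩
        rw [h2]
    _ = ρ.real univ * H b ^ 2 - ∫ x, H x ^ 2 ∂ρ := by
        rw [integral_sub (integrable_const _) hH2, integral_const, smul_eq_mul]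

instance isFiniteMeasure_mu01 : IsFiniteMeasure mu01 := by
  unfold mu01; infer_instance

instance isFiniteMeasure_muDelay : IsFiniteMeasure muDelay := by
  unfold muDelay; infer_instance

lemma ae_mu01_mem_Icc : ∀ᵐ x ∂mu01, x ∈ Icc (0 : ℝ) 1 :=
  ae_restrict_mem measurableSet_Icc

lemma mu01_real_univ : mu01.real univ = 1 := by
  simp [mu01, Measure.real]

lemma measurable_measureReal_Iic (ρ : Measure ℝ) [IsFiniteMeasure ρ] :
    Measurable fun x => ρ.real (Iic x) :=
  Monotone.measurable fun _ _ h => measureReal_mono (Iic_subset_Iic.2 h)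

/-- Energy balance for the transport equation on `[0,1]` with an affine weight. -/
lemma transport_energy_balance {d c m : ℝ} {F G : ℝ → ℝ} (hd : d ≠ 0) (hG : Integrable G mu01)
    (hF : ∀ x ∈ Icc (0 : ℝ) 1, F x = F 0 + ∫ s in (0 : ℝ)..x, -d⁻¹ * G s) :
    2 * ∫ x, (c - m * x) / d * (F x * G x) ∂mu01 =
      c * F 0 ^ 2 - (c - m) * F 1 ^ 2 - m * ∫ x, F x ^ 2 ∂mu01 := by
  have hg : IntegrableOn (fun s => -d⁻¹ * G s) (Icc 0 1) := hG.const_mul _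
  have hgi := (intervalIntegrable_iff_integrableOn_Icc_of_le zero_le_one).2 hg
  have h1 := integral_two_mul_eq_sq_sub_sq zero_le_one hgi hF (σ := 0) (by simp)
  have h2 := integral_measureReal_Iic_mul_eq zero_le_one hg hF mu01 (by simp [mu01])
  rw [mu01_real_univ, one_mul] at h2
  rw [intervalIntegral.integral_of_le zero_le_one, ← integral_Icc_eq_integral_Ioc] at h1
  have hFc : ContinuousOn F (Icc 0 1) := by
    have h1 : ContinuousOn (fun x => F 0 + ∫ s in (0 : ℝ)..x, -d⁻¹ * G s) (Icc 0 1) := by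
      have := intervalIntegral.continuousOn_primitive_interval' hgi (a := 0) (by simp)
      rw [uIcc_of_le zero_le_one] at this
      exact continuousOn_const.add this
    exact h1.congr hF
  set q : ℝ → ℝ := fun x => 2 * (F x * (-d⁻¹ * G x)) with hq
  have hqi : Integrable q mu01 := by
    have : IntegrableOn (fun x => F x * (-d⁻¹ * G x)) (Icc 0 1) :=
      hg.continuousOn_mul hFc isCompact_Icc
    exact this.const_mul 2
  have hqi' : Integrable (fun x => mu01.real (Iic x) * q x) mu01 :=
    hqi.bdd_mul (measurable_measureReal_Iic _).aestronglyMeasurable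
      (c := mu01.real univ)
      (Eventually.of_forall fun x => by
        rw [Real.norm_of_nonneg measureReal_nonneg]; exact measureReal_mono (subset_univ _))
  have h3 : ∫ x, (2 * ((c - m * x) / d * (F x * G x))) ∂mu01 =
      ∫ x, (m * (mu01.real (Iic x) * q x) - c * q x) ∂mu01 := by
    refine integral_congr_ae ?_
    filter_upwards [ae_mu01_mem_Icc] with x hx
    have : mu01.real (Iic x) = x := by
      have : Iic x ∩ Icc 0 1 = Icc 0 x := by
        ext y; simp only [mem_inter_iff, mem_Iic, mem_Icc]
        exact ⟨fun h => ⟨h.2.1, h.1⟩, fun h => ⟨h.2, h.1, h.2.trans hx.2⟩⟩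
      simp [mu01, measureReal_restrict_apply measurableSet_Iic, this, hx.1]
    rw [this]
    simp only [hq]
    field_simp
    ring
  rw [← integral_const_mul, h3, integral_sub (hqi'.const_mul m) (hqi.const_mul c),
    integral_const_mul, integral_const_mul]
  change ∫ x, q x ∂mu01 = _ at h1
  change ∫ x, mu01.real (Iic x) * q x ∂mu01 = _ at h2
  rw [h1, h2]
  ring

section Delay

variable {f : ℝ → ℝ} {φ ψ : ℝ × ℝ → ℝ}

lemma ae_integrableOn_history (hψ : MemLp ψ 2 muDelay) :
    ∀ᵐ x ∂mu01, MemLp (fun τ => ψ (τ, x)) 2 (volume.restrict (Icc (-1 : ℝ) 0)) := by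
  have h1 : ∀ᵐ x ∂mu01, Integrable (fun τ => ψ (τ, x) ^ 2) (volume.restrict (Icc (-1 : ℝ) 0)) :=
    hψ.integrable_sq.prod_left_ae
  have h2 : ∀ᵐ x ∂mu01, AEStronglyMeasurable (fun τ => ψ (τ, x))
      (volume.restrict (Icc (-1 : ℝ) 0)) :=
    (hψ.integrable (by norm_num)).prod_left_ae.mono fun x hx => hx.aestronglyMeasurable
  filter_upwards [h1, h2] with x hx1 hx2
  exact (memLp_two_iff_integrable_sq hx2).2 hx1

/-- The history function of a state in the domain is square integrable for every finite measure
in the delay variable. -/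
lemma memLp_history (hf : MemLp f 2 mu01) (hψ : MemLp ψ 2 muDelay)
    (hφ : ∀ x ∈ Icc (0 : ℝ) 1, ∀ θ ∈ Icc (-1 : ℝ) 0,
      φ (θ, x) = φ (-1, x) + ∫ τ in (-1 : ℝ)..θ, ψ (τ, x))
    (hφ0 : ∀ x ∈ Icc (0 : ℝ) 1, φ (0, x) = f x)
    (ρ : Measure ℝ) [IsFiniteMeasure ρ] (hρ : ρ (Icc (-1 : ℝ) 0)ᶜ = 0) :
    MemLp φ 2 (ρ.prod mu01) := by
  set η : Measure ℝ := volume.restrict (Icc (-1 : ℝ) 0) with hη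
  obtain ⟨f', hf'm, hff'⟩ := hf.aestronglyMeasurable
  obtain ⟨ψ', hψ'm, hψψ'⟩ := hψ.aestronglyMeasurable
  have hψ' : MemLp ψ' 2 muDelay := hψ.ae_eq hψψ'
  have hf' : MemLp f' 2 mu01 := hf.ae_eq hff'
  have hslice : ∀ᵐ x ∂mu01, ∀ᵐ τ ∂η, ψ (τ, x) = ψ' (τ, x) :=
    Measure.ae_ae_of_ae_prod (p := fun p : ℝ × ℝ => ψ p.swap = ψ' p.swap)
      (Measure.measurePreserving_swap.quasiMeasurePreserving.ae hψψ')
  let χ : ℝ × ℝ → ℝ := fun p => f' p.2 - ∫ τ, (Ioc p.1 0).indicator (fun τ => ψ' (τ, p.2)) τ ∂η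
  have hχm : StronglyMeasurable χ := by
    refine (hf'm.comp_measurable measurable_snd).sub ?_
    have h1 : StronglyMeasurable fun r : (ℝ × ℝ) × ℝ =>
        {r : (ℝ × ℝ) × ℝ | r.1.1 < r.2 ∧ r.2 ≤ 0}.indicator (fun r => ψ' (r.2, r.1.2)) r := by
      refine (hψ'm.comp_measurable (by fun_prop)).indicator ?_
      have hlt : MeasurableSet {r : (ℝ × ℝ) × ℝ | r.1.1 < r.2} :=
        measurableSet_lt (by fun_prop) (by fun_prop)
      have hle : MeasurableSet {r : (ℝ × ℝ) × ℝ | r.2 ≤ 0} :=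
        measurableSet_le (by fun_prop) (by fun_prop)
      exact hlt.inter hle
    have h2 := h1.integral_prod_right' (ν := η)
    exact h2
  have hae : φ =ᵐ[ρ.prod mu01] χ := by
    have hx : ∀ᵐ x ∂mu01, ∀ θ ∈ Icc (-1 : ℝ) 0, φ (θ, x) = χ (θ, x) := by
      filter_upwards [ae_mu01_mem_Icc, hff', hslice, ae_integrableOn_history hψ]
        with x hx hfx hψx hint θ hθ
      have hi : IntervalIntegrable (fun τ => ψ (τ, x)) volume (-1) 0 :=
        (intervalIntegrable_iff_integrableOn_Icc_of_le (by norm_num)).2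
          (hint.integrable (by norm_num))
      have hi1 : IntervalIntegrable (fun τ => ψ (τ, x)) volume (-1) θ :=
        hi.mono_set (by
          rw [uIcc_of_le hθ.1, uIcc_of_le (by norm_num)]; exact Icc_subset_Icc_right hθ.2)
      have hi2 : IntervalIntegrable (fun τ => ψ (τ, x)) volume θ 0 :=
        hi.mono_set (by
          rw [uIcc_of_le hθ.2, uIcc_of_le (by norm_num)]; exact Icc_subset_Icc_left hθ.1)
      have e0 := hφ x hx 0 (by norm_num)
      have e1 := hφ x hx θ hθ
      rw [← intervalIntegral.integral_add_adjacent_intervals hi1 hi2, hφ0 x hx] at e0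
      have e2 : ∫ τ in θ..0, ψ (τ, x) =
          ∫ τ, (Ioc θ 0).indicator (fun τ => ψ' (τ, x)) τ ∂η := by
        rw [integral_indicator measurableSet_Ioc, hη,
          Measure.restrict_restrict measurableSet_Ioc,
          inter_eq_left.2 (show Ioc θ 0 ⊆ Icc (-1) 0 from
            fun τ hτ => ⟨hθ.1.trans hτ.1.le, hτ.2⟩), intervalIntegral.integral_of_le hθ.2]
        refine integral_congr_ae ?_
        exact ae_restrict_of_ae_restrict_of_subset
          (show Ioc θ 0 ⊆ Icc (-1) 0 from fun τ hτ => ⟨hθ.1.trans hτ.1.le, hτ.2⟩) hψx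
      simp only [χ]
      rw [← e2, ← hfx]
      linarith
    have hρae : ∀ᵐ θ ∂ρ, θ ∈ Icc (-1 : ℝ) 0 := hρ
    filter_upwards [Measure.quasiMeasurePreserving_snd.ae hx,
      Measure.quasiMeasurePreserving_fst.ae hρae] with p hp1 hp2
    exact hp1 p.1 hp2
  refine (MemLp.ae_eq hae.symm ?_)
  rw [memLp_two_iff_integrable_sq hχm.aestronglyMeasurable]
  have hbound : Integrable (fun x => 2 * f' x ^ 2 + 2 * ∫ τ, ψ' (τ, x) ^ 2 ∂η) mu01 := by
    have h1 : Integrable (fun x => ∫ τ, ψ' (τ, x) ^ 2 ∂η) mu01 :=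
      hψ'.integrable_sq.integral_prod_right
    exact (hf'.integrable_sq.const_mul 2).add (h1.const_mul 2)
  refine (hbound.comp_snd ρ).mono' (hχm.pow 2).aestronglyMeasurable ?_
  filter_upwards [Measure.quasiMeasurePreserving_snd.ae (ae_integrableOn_history hψ')] with p hp
  rw [Real.norm_of_nonneg (sq_nonneg _)]
  have h1 := sq_integral_le_measure_mul_integral_sq
    (hp.indicator (measurableSet_Ioc (a := p.1) (b := 0)))
  have hη1 : η.real univ = 1 := by simp [hη, Measure.real]
  rw [hη1, one_mul] at h1
  have h2 : ∫ τ, (Ioc p.1 0).indicator (fun τ => ψ' (τ, p.2)) τ ^ 2 ∂η ≤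
      ∫ τ, ψ' (τ, p.2) ^ 2 ∂η := by
    refine integral_mono_of_nonneg (Eventually.of_forall fun τ => sq_nonneg _) hp.integrable_sq
      (Eventually.of_forall fun τ => ?_)
    by_cases hτ : τ ∈ Ioc p.1 0
    · simp [indicator_of_mem hτ]
    · simp [indicator_of_notMem hτ, sq_nonneg]
  simp only [χ]
  nlinarith [sq_nonneg (f' p.2 + ∫ τ, (Ioc p.1 0).indicator (fun τ => ψ' (τ, p.2)) τ ∂η)]

/-- Energy balance for the history function, weighted by the distribution function of a finite
measure on `[-1,0]`. -/
lemma history_energy_balance (hf : MemLp f 2 mu01) (hψ : MemLp ψ 2 muDelay)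
    (hφ : ∀ x ∈ Icc (0 : ℝ) 1, ∀ θ ∈ Icc (-1 : ℝ) 0,
      φ (θ, x) = φ (-1, x) + ∫ τ in (-1 : ℝ)..θ, ψ (τ, x))
    (hφ0 : ∀ x ∈ Icc (0 : ℝ) 1, φ (0, x) = f x)
    (ρ : Measure ℝ) [IsFiniteMeasure ρ] (hρ : ρ (Icc (-1 : ℝ) 0)ᶜ = 0) :
    Integrable (fun p => ρ.real (Iic p.1) * (φ p * ψ p)) muDelay ∧
    2 * ∫ p, ρ.real (Iic p.1) * (φ p * ψ p) ∂muDelay =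
      ρ.real univ * ∫ x, f x ^ 2 ∂mu01 - ∫ p, φ p ^ 2 ∂(ρ.prod mu01) := by
  have hφD : MemLp φ 2 muDelay :=
    memLp_history hf hψ hφ hφ0 (volume.restrict (Icc (-1 : ℝ) 0)) (by simp)
  have hφρ : MemLp φ 2 (ρ.prod mu01) := memLp_history hf hψ hφ hφ0 ρ hρ
  have hint : Integrable (fun p => ρ.real (Iic p.1) * (φ p * ψ p)) muDelay :=
    (hφD.integrable_mul hψ).bdd_mul
      ((measurable_measureReal_Iic ρ).comp measurable_fst).aestronglyMeasurable
      (c := ρ.real univ)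
      (Eventually.of_forall fun p => by
        rw [Real.norm_of_nonneg measureReal_nonneg]; exact measureReal_mono (subset_univ _))
  refine ⟨hint, ?_⟩
  rw [← integral_const_mul, muDelay, integral_prod_symm _ (hint.const_mul 2),
    integral_prod_symm _ hφρ.integrable_sq, ← integral_const_mul,
    ← integral_sub (hf.integrable_sq.const_mul _) hφρ.integrable_sq.integral_prod_right]
  refine integral_congr_ae ?_
  filter_upwards [ae_mu01_mem_Icc, ae_integrableOn_history hψ] with x hx hψx
  have h1 := integral_measureReal_Iic_mul_eq (a := -1) (b := 0) (by norm_num)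
    (H := fun θ => φ (θ, x)) (hψx.integrable (by norm_num)) (hφ x hx) ρ hρ
  simp only [hφ0 x hx] at h1
  rw [← h1]
  refine integral_congr_ae (Eventually.of_forall fun θ => ?_)
  simp only
  ring

end Delay

/-- A nonnegative matrix whose row sums are bounded by some `κ < 1` admits a positive vector that it
strictly contracts from the left. -/
lemma exists_pos_left_contracted {n : ℕ} (k : Fin n → Fin n → ℝ) (hk : ∀ i j, 0 ≤ k i j) {κ : ℝ}
    (hκ1 : κ < 1) (hκ0 : 0 ≤ κ) (hrow : ∀ i, ∑ j, k i j ≤ κ) :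
    ∃ c : Fin n → ℝ, ∃ g > 0, (∀ j, 0 < c j) ∧ ∀ j, ∑ i, c i * k i j + g ≤ c j := by
  let v : ℕ → Fin n → ℝ := fun m => Nat.rec (fun _ => 1) (fun _ u j => ∑ i, u i * k i j) m
  have hv0 : ∀ j, v 0 j = 1 := fun j => rfl
  have hvs : ∀ m j, v (m + 1) j = ∑ i, v m i * k i j := fun m j => rfl
  have hvn : ∀ m j, 0 ≤ v m j := by
    intro m
    induction m with
    | zero => intro j; rw [hv0]; norm_num
    | succ m ih => intro j; rw [hvs]; exact Finset.sum_nonneg fun i _ => mul_nonneg (ih i) (hk i j)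
  have hsum : ∀ m, ∑ j, v m j ≤ n * κ ^ m := by
    intro m
    induction m with
    | zero => simp [hv0]
    | succ m ih =>
      calc ∑ j, v (m + 1) j = ∑ i, v m i * ∑ j, k i j := by
            simp_rw [hvs, Finset.mul_sum]; exact Finset.sum_comm
        _ ≤ ∑ i, v m i * κ :=
            Finset.sum_le_sum fun i _ => mul_le_mul_of_nonneg_left (hrow i) (hvn m i)
        _ = (∑ i, v m i) * κ := by rw [Finset.sum_mul]
        _ ≤ n * κ ^ m * κ := mul_le_mul_of_nonneg_right ih hκ0
        _ = n * κ ^ (m + 1) := by ring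
  have hlim : Tendsto (fun m : ℕ => (n : ℝ) * κ ^ m) atTop (nhds 0) := by
    simpa using (tendsto_pow_atTop_nhds_zero_of_lt_one hκ0 hκ1).const_mul (n : ℝ)
  obtain ⟨N, hN, hN1⟩ := ((hlim.eventually_lt_const (show (0 : ℝ) < 1 / 2 by norm_num)).and
    (eventually_ge_atTop 1)).exists
  refine ⟨fun j => ∑ m ∈ Finset.range N, v m j, 1 / 2, by norm_num, fun j => ?_, fun j => ?_⟩
  · have := Finset.single_le_sum (f := fun m => v m j) (fun m _ => hvn m j)
      (Finset.mem_range.2 (show 0 < N by omega))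
    simp only [hv0] at this
    linarith
  · have h1 : ∑ i, (∑ m ∈ Finset.range N, v m i) * k i j = ∑ m ∈ Finset.range N, v (m + 1) j := by
      simp_rw [hvs, Finset.sum_mul]; exact Finset.sum_comm
    have h2 := Finset.sum_range_succ (fun m => v m j) N
    rw [Finset.sum_range_succ'] at h2
    have h3 : v N j ≤ ∑ j, v N j :=
      Finset.single_le_sum (f := fun j => v N j) (fun j _ => hvn N j) (Finset.mem_univ j)
    have h4 := hsum N
    rw [hv0] at h2
    rw [h1]
    linarith

/-- The weight of the history component of the Lyapunov functional. -/
noncomputable def historyWeight {n : ℕ} (ν : Fin n → Fin n → Measure ℝ) (c : Fin n → ℝ) (ε : ℝ)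
    (j : Fin n) (p : ℝ × ℝ) : ℝ :=
  ∑ i, c i * (ν i j).real (Iic p.1) + ε * (volume.restrict (Icc (-1 : ℝ) 0)).real (Iic p.1) +
    ε * (Measure.dirac (-1 : ℝ)).real (Iic p.1)

lemma memLp_top_historyWeight {n : ℕ} (ν : Fin n → Fin n → Measure ℝ)
    [∀ i j, IsFiniteMeasure (ν i j)] (c : Fin n → ℝ) (ε : ℝ) (j : Fin n) :
    MemLp (historyWeight ν c ε j) ⊤ muDelay := by
  have h : ∀ (ρ : Measure ℝ) [IsFiniteMeasure ρ],
      MemLp (fun p : ℝ × ℝ => ρ.real (Iic p.1)) ⊤ muDelay := fun ρ _ =>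
    memLp_top_of_bound ((measurable_measureReal_Iic ρ).comp measurable_fst).aestronglyMeasurable
      (ρ.real univ) (Eventually.of_forall fun p => by
        rw [Real.norm_of_nonneg measureReal_nonneg]; exact measureReal_mono (subset_univ _))
  exact ((memLp_finsetSum _ fun i _ => (h (ν i j)).const_mul (c i)).add
    ((h _).const_mul ε)).add ((h _).const_mul ε)

lemma ae_le_historyWeight {n : ℕ} (ν : Fin n → Fin n → Measure ℝ) {c : Fin n → ℝ}
    (hc : ∀ i, 0 < c i) {ε : ℝ} (hε : 0 < ε) (j : Fin n) :
    ∀ᵐ p ∂muDelay, ε ≤ historyWeight ν c ε j p := by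
  have h : ∀ᵐ θ ∂(volume.restrict (Icc (-1 : ℝ) 0)), θ ∈ Icc (-1 : ℝ) 0 :=
    ae_restrict_mem measurableSet_Icc
  have h' : ∀ᵐ p ∂muDelay, p.1 ∈ Icc (-1 : ℝ) 0 := Measure.quasiMeasurePreserving_fst.ae h
  filter_upwards [h'] with p hp
  have h1 : (Measure.dirac (-1 : ℝ)).real (Iic p.1) = 1 := by
    simp [Measure.real, Measure.dirac_apply' _ measurableSet_Iic, hp.1]
  have h2 : 0 ≤ ∑ i, c i * (ν i j).real (Iic p.1) :=
    Finset.sum_nonneg fun i _ => mul_nonneg (hc i).le measureReal_nonneg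
  have h3 : 0 ≤ ε * (volume.restrict (Icc (-1 : ℝ) 0)).real (Iic p.1) :=
    mul_nonneg hε.le measureReal_nonneg
  rw [historyWeight, h1]
  linarith

/-- Dissipation of the Lyapunov functional on the domain of the closed-loop generator. -/
lemma DelayGen.dissipation {n : ℕ} {d : Fin n → ℝ} (hd : ∀ i, 0 < d i)
    {ν : Fin n → Fin n → Measure ℝ} [∀ i j, IsFiniteMeasure (ν i j)]
    (hsupp : ∀ i j, ν i j (Icc (-1 : ℝ) 0)ᶜ = 0)
    (hrow : ∀ i, ∑ j, (ν i j).real univ ≤ 1) {c : Fin n → ℝ} (hc : ∀ i, 0 < c i) {ε : ℝ}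
    (hε : 0 < ε) (hgap : ∀ j, ∑ i, c i * (ν i j).real univ + 4 * ε ≤ c j)
    {z w : DelayState n} (h : DelayGen d ν z w) :
    2 * ((∑ j, ∫ x, (c j - (c j - ε) * x) / d j * (z.1 x j * w.1 x j) ∂mu01) +
      ∑ j, ∫ p, historyWeight ν c ε j p * (z.2 p j * w.2 p j) ∂muDelay) ≤ -ε * ‖z‖ ^ 2 := by
  obtain ⟨F, G, Φ, Ψ, hzF, hwG, hzΦ, hwΨ, hF, hΦ, hΦ0, hbc⟩ := h
  have hFL : ∀ j, MemLp (fun x => F x j) 2 mu01 := fun j =>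
    (memLp_component z.1 j).ae_eq (hzF.mono fun x hx => by simp only [hx])
  have hGL : ∀ j, MemLp (fun x => G x j) 2 mu01 := fun j =>
    (memLp_component w.1 j).ae_eq (hwG.mono fun x hx => by simp only [hx])
  have hΨL : ∀ j, MemLp (fun p => Ψ p j) 2 muDelay := fun j =>
    (memLp_component w.2 j).ae_eq (hwΨ.mono fun x hx => by simp only [hx])
  have hΦL : ∀ j (ρ : Measure ℝ) [IsFiniteMeasure ρ], ρ (Icc (-1 : ℝ) 0)ᶜ = 0 →
      MemLp (fun p => Φ p j) 2 (ρ.prod mu01) := fun j ρ _ hρ =>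
    memLp_history (hFL j) (hΨL j) (fun x hx => hΦ x hx j) (fun x hx => hΦ0 x hx j) ρ hρ
  have hbal : ∀ j (ρ : Measure ℝ) [IsFiniteMeasure ρ], ρ (Icc (-1 : ℝ) 0)ᶜ = 0 →
      Integrable (fun p => ρ.real (Iic p.1) * (Φ p j * Ψ p j)) muDelay ∧
      2 * ∫ p, ρ.real (Iic p.1) * (Φ p j * Ψ p j) ∂muDelay =
      ρ.real univ * ∫ x, F x j ^ 2 ∂mu01 - ∫ p, Φ p j ^ 2 ∂(ρ.prod mu01) := fun j ρ _ hρ =>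
    history_energy_balance (hFL j) (hΨL j) (fun x hx => hΦ x hx j) (fun x hx => hΦ0 x hx j) ρ hρ
  set A : Fin n → ℝ := fun j => ∫ x, F x j ^ 2 ∂mu01 with hA
  set D : Fin n → ℝ := fun j => ∫ p, Φ p j ^ 2 ∂muDelay with hD
  set S : Fin n → Fin n → ℝ := fun i j => ∫ p, Φ p j ^ 2 ∂((ν i j).prod mu01) with hS
  have hA0 : ∀ j, 0 ≤ A j := fun j => integral_nonneg fun x => sq_nonneg _
  have hS0 : ∀ i j, 0 ≤ S i j := fun i j => integral_nonneg fun x => sq_nonneg _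
  have hnorm : ‖z‖ ^ 2 ≤ ∑ j, A j + ∑ j, D j := by
    have h1 : ‖z.1‖ ^ 2 ≤ ∑ j, A j := by
      refine (norm_sq_le_sum_integral_sq z.1).trans_eq (Finset.sum_congr rfl fun j _ => ?_)
      exact integral_congr_ae (hzF.mono fun x hx => by simp only [hx])
    have h2 : ‖z.2‖ ^ 2 ≤ ∑ j, D j := by
      refine (norm_sq_le_sum_integral_sq z.2).trans_eq (Finset.sum_congr rfl fun j _ => ?_)
      exact integral_congr_ae (hzΦ.mono fun x hx => by simp only [hx])
    rw [Prod.norm_def]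
    rcases max_choice ‖z.1‖ ‖z.2‖ with h | h <;> rw [h] <;>
      nlinarith [sq_nonneg ‖z.1‖, sq_nonneg ‖z.2‖]
  have hboundary : ∀ i, F 0 i ^ 2 ≤ ∑ j, S i j := by
    intro i
    have h1 : ∀ j, ∫ θ, (∫ x, Φ (θ, x) j ∂mu01) ∂(ν i j) = ∫ p, Φ p j ∂((ν i j).prod mu01) :=
      fun j => (integral_prod _ ((hΦL j (ν i j) (hsupp i j)).integrable (by norm_num))).symm
    have h2 : ∀ j, (∫ p, Φ p j ∂((ν i j).prod mu01)) ^ 2 ≤ (ν i j).real univ * S i j := fun j => by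
      have := sq_integral_le_measure_mul_integral_sq (hΦL j (ν i j) (hsupp i j))
      rwa [← univ_prod_univ, measureReal_prod_prod, mu01_real_univ, mul_one] at this
    rw [hbc i]
    simp_rw [h1]
    calc (∑ j, ∫ p, Φ p j ∂((ν i j).prod mu01)) ^ 2
        ≤ (∑ j, (ν i j).real univ) * ∑ j, S i j :=
          Finset.sum_sq_le_sum_mul_sum_of_sq_le_mul _ (fun j _ => measureReal_nonneg)
            (fun j _ => hS0 i j) fun j _ => h2 j
      _ ≤ 1 * ∑ j, S i j :=
          mul_le_mul_of_nonneg_right (hrow i) (Finset.sum_nonneg fun j _ => hS0 i j)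
      _ = ∑ j, S i j := one_mul _
  have htransport : ∀ j, 2 * ∫ x, (c j - (c j - ε) * x) / d j * (z.1 x j * w.1 x j) ∂mu01 ≤
      c j * F 0 j ^ 2 - (c j - ε) * A j := by
    intro j
    have h1 : ∫ x, (c j - (c j - ε) * x) / d j * (z.1 x j * w.1 x j) ∂mu01 =
        ∫ x, (c j - (c j - ε) * x) / d j * (F x j * G x j) ∂mu01 := by
      refine integral_congr_ae ?_
      filter_upwards [hzF, hwG] with x h1 h2
      rw [h1, h2]
    rw [h1, transport_energy_balance (F := fun x => F x j) (G := fun x => G x j) (hd j).ne'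
      ((hGL j).integrable (by norm_num)) (hF j)]
    nlinarith [mul_nonneg hε.le (sq_nonneg (F 1 j))]
  have hhistory : ∀ j, 2 * ∫ p, historyWeight ν c ε j p * (z.2 p j * w.2 p j) ∂muDelay ≤
      ∑ i, c i * (ν i j).real univ * A j - ∑ i, c i * S i j + 2 * ε * A j - ε * D j := by
    intro j
    have hν := fun i => hbal j (ν i j) (hsupp i j)
    have hvol := hbal j (volume.restrict (Icc (-1 : ℝ) 0)) (by simp)
    have hdir := hbal j (Measure.dirac (-1 : ℝ)) (by simp)
    have hvol1 : (volume.restrict (Icc (-1 : ℝ) 0)).real univ = 1 := by simp [Measure.real]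
    have hdir0 : 0 ≤ ∫ p, Φ p j ^ 2 ∂((Measure.dirac (-1 : ℝ)).prod mu01) :=
      integral_nonneg fun x => sq_nonneg _
    have h1 : ∫ p, historyWeight ν c ε j p * (z.2 p j * w.2 p j) ∂muDelay =
        ∫ p, (∑ i, c i * ((ν i j).real (Iic p.1) * (Φ p j * Ψ p j)) +
          ε * ((volume.restrict (Icc (-1 : ℝ) 0)).real (Iic p.1) * (Φ p j * Ψ p j)) +
          ε * ((Measure.dirac (-1 : ℝ)).real (Iic p.1) * (Φ p j * Ψ p j))) ∂muDelay := by
      refine integral_congr_ae ?_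
      filter_upwards [hzΦ, hwΨ] with p h1 h2
      rw [h1, h2, historyWeight, add_mul, add_mul, Finset.sum_mul]
      simp only [mul_assoc]
    have hsumint : Integrable (fun p => ∑ i, c i * ((ν i j).real (Iic p.1) * (Φ p j * Ψ p j)))
        muDelay := integrable_finsetSum _ fun i _ => (hν i).1.const_mul (c i)
    have hsum2 : Integrable (fun p => ∑ i, c i * ((ν i j).real (Iic p.1) * (Φ p j * Ψ p j)) +
        ε * ((volume.restrict (Icc (-1 : ℝ) 0)).real (Iic p.1) * (Φ p j * Ψ p j))) muDelay :=
      hsumint.add (hvol.1.const_mul ε)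
    rw [h1, integral_add hsum2 (hdir.1.const_mul ε),
      integral_add hsumint (hvol.1.const_mul ε),
      integral_finsetSum _ fun i _ => (hν i).1.const_mul (c i)]
    simp only [integral_const_mul]
    have h2 : 2 * ∑ i, c i * ∫ p, (ν i j).real (Iic p.1) * (Φ p j * Ψ p j) ∂muDelay =
        ∑ i, c i * (ν i j).real univ * A j - ∑ i, c i * S i j := by
      rw [Finset.mul_sum, ← Finset.sum_sub_distrib]
      refine Finset.sum_congr rfl fun i _ => ?_
      rw [mul_left_comm, (hν i).2]
      ring
    have h3 := hvol.2
    have h4 := hdir.2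
    rw [hvol1, one_mul] at h3
    rw [probReal_univ, one_mul] at h4
    change _ = A j - D j at h3
    change _ = A j - _ at h4
    nlinarith [mul_nonneg hε.le hdir0]
  have hswap : ∑ j, c j * F 0 j ^ 2 ≤ ∑ j, ∑ i, c i * S i j := by
    rw [Finset.sum_comm]
    refine Finset.sum_le_sum fun i _ => ?_
    rw [← Finset.mul_sum]
    exact mul_le_mul_of_nonneg_left (hboundary i) (hc i).le
  have htotal : ∀ j, 2 * ∫ x, (c j - (c j - ε) * x) / d j * (z.1 x j * w.1 x j) ∂mu01 +
      2 * ∫ p, historyWeight ν c ε j p * (z.2 p j * w.2 p j) ∂muDelay ≤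
      c j * F 0 j ^ 2 - ∑ i, c i * S i j - ε * A j - ε * D j := by
    intro j
    have h1 := htransport j
    have h2 := hhistory j
    rw [← Finset.sum_mul] at h2
    nlinarith [mul_le_mul_of_nonneg_right (hgap j) (hA0 j)]
  have hfinal := Finset.sum_le_sum fun j (_ : j ∈ Finset.univ) => htotal j
  simp only [Finset.sum_add_distrib, Finset.sum_sub_distrib, ← Finset.mul_sum] at hfinal hswap
  nlinarith [mul_le_mul_of_nonneg_left hnorm hε.le]

/-- If `μ = (ν i j)` is a positive operator-valued function of
bounded variation on `[-1,0]` with `μ(0) = 0` and total variation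
`|μ|([-1,0]) < 1`, then the closed-loop semigroup of the hyperbolic system with
delayed boundary condition on `𝒳 × L²([-1,0], 𝒳)` is uniformly exponentially
stable. -/
theorem delayed_hyperbolic_stability
    (n : ℕ) (d : Fin n → ℝ) (hd : ∀ i, 0 < d i)
    (ν : Fin n → Fin n → Measure ℝ) [∀ i j, IsFiniteMeasure (ν i j)]
    (hsupp : ∀ i j, ν i j (Icc (-1 : ℝ) 0)ᶜ = 0)
    (hzero : ∀ i j, ν i j {0} = 0)
    -- total variation `|μ|([-1,0]) < 1`:
    (hsmall : ‖(Matrix.of fun i j : Fin n => (ν i j Set.univ).toReal)‖ < 1)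
    -- `(T(t))` is the associated closed-loop C₀-semigroup:
    (T : ℝ → DelayState n →L[ℝ] DelayState n)
    (hT0 : T 0 = 1)
    (hTadd : ∀ t s : ℝ, 0 ≤ t → 0 ≤ s → T (t + s) = (T t).comp (T s))
    (hTcont : ∀ z : DelayState n, ContinuousOn (fun t => T t z) (Ici (0 : ℝ)))
    (hTgen : ∀ z w : DelayState n,
      Tendsto (fun t : ℝ => t⁻¹ • (T t z - z)) (nhdsWithin 0 (Ioi 0)) (nhds w) ↔
        DelayGen d ν z w) :
    -- uniform exponential stability:
    ∃ M ω : ℝ, 0 < M ∧ ω < 0 ∧ ∀ t : ℝ, 0 ≤ t → ‖T t‖ ≤ M * Real.exp (ω * t) := by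
  set κ := ‖(Matrix.of fun i j : Fin n => (ν i j Set.univ).toReal)‖ with hκ
  have hrow : ∀ i, ∑ j, (ν i j).real univ ≤ κ := by
    intro i
    have h1 := Finset.le_sup (f := fun i : Fin n =>
      ∑ j, ‖(Matrix.of fun i j : Fin n => (ν i j Set.univ).toReal) i j‖₊) (Finset.mem_univ i)
    rw [hκ, Matrix.linfty_opNorm_def]
    refine le_trans (le_of_eq ?_) (NNReal.coe_le_coe.2 h1)
    push_cast
    refine Finset.sum_congr rfl fun j _ => ?_
    rw [Matrix.of_apply, Real.norm_of_nonneg ENNReal.toReal_nonneg, Measure.real]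
  obtain ⟨c, g, hg, hc, hgap⟩ := exists_pos_left_contracted (fun i j => (ν i j).real univ)
    (fun i j => measureReal_nonneg) hsmall (norm_nonneg _) hrow
  have hε : 0 < g / 4 := by positivity
  set ε := g / 4 with hεg
  have hgap' : ∀ j, ∑ i, c i * (ν i j).real univ + 4 * ε ≤ c j := fun j => by
    have := hgap j
    rw [hεg]; linarith
  have hεc : ∀ j, ε ≤ c j := fun j => by
    have h1 : 0 ≤ ∑ i, c i * (ν i j).real univ :=
      Finset.sum_nonneg fun i _ => mul_nonneg (hc i).le measureReal_nonneg
    linarith [hgap' j]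
  let k : Fin n → ℝ → ℝ := fun j x => (c j - (c j - ε) * x) / d j
  have hkL : ∀ j, MemLp (k j) ⊤ mu01 := fun j => by
    refine memLp_top_of_bound (by fun_prop) (c j / d j) ?_
    filter_upwards [ae_mu01_mem_Icc] with x hx
    have h1 : 0 ≤ (c j - ε) * x := mul_nonneg (by linarith [hεc j]) hx.1
    have h2 : (c j - ε) * x ≤ c j - ε := mul_le_of_le_one_right (by linarith [hεc j]) hx.2
    rw [Real.norm_of_nonneg (div_nonneg (by linarith) (hd j).le)]
    exact div_le_div_of_nonneg_right (by linarith) (hd j).le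
  obtain ⟨δ, hδ, hδd⟩ : ∃ δ > 0, ∀ j, δ ≤ ε / d j := by
    have hpos : ∀ j, 0 < ε / d j := fun j => div_pos hε (hd j)
    have hsum : ∀ j, (ε / d j)⁻¹ ≤ 1 + ∑ i, (ε / d i)⁻¹ := fun j => by
      have := Finset.single_le_sum (f := fun i => (ε / d i)⁻¹) (fun i _ => (inv_pos.2 (hpos i)).le)
        (Finset.mem_univ j)
      linarith
    refine ⟨(1 + ∑ i, (ε / d i)⁻¹)⁻¹, inv_pos.2 ?_, fun j => inv_le_of_inv_le₀ (hpos j) (hsum j)⟩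
    have := Finset.sum_nonneg fun i (_ : i ∈ Finset.univ) => (inv_pos.2 (hpos i)).le
    linarith
  have hkδ : ∀ j, ∀ᵐ x ∂mu01, δ ≤ k j x := fun j => by
    filter_upwards [ae_mu01_mem_Icc] with x hx
    have h2 : (c j - ε) * x ≤ c j - ε := mul_le_of_le_one_right (by linarith [hεc j]) hx.2
    exact (hδd j).trans (div_le_div_of_nonneg_right (by linarith) (hd j).le)
  have hpL := memLp_top_historyWeight ν c ε
  have hpε := fun j => ae_le_historyWeight ν hc hε j
  obtain ⟨W₁, hW₁⟩ := exists_weighted_form k hkL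
  obtain ⟨W₂, hW₂⟩ := exists_weighted_form (historyWeight ν c ε) hpL
  let B : DelayState n →L[ℝ] DelayState n →L[ℝ] ℝ :=
    W₁.bilinearComp (ContinuousLinearMap.fst ℝ _ _) (ContinuousLinearMap.fst ℝ _ _) +
      W₂.bilinearComp (ContinuousLinearMap.snd ℝ _ _) (ContinuousLinearMap.snd ℝ _ _)
  have hB : ∀ u v, B u v = W₁ u.1 v.1 + W₂ u.2 v.2 := fun u v => rfl
  refine exponentially_stable_of_quadratic_lyapunov hT0 hTadd hTcont B (a := min δ ε)
    (lt_min hδ hε) hε (fun z => ?_) fun z w hzw => ?_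
  · have h1 := weighted_form_coercive hkL hδ.le hkδ z.1
    have h2 := weighted_form_coercive hpL hε.le hpε z.2
    rw [hB, hW₁, hW₂]
    have h3 := mul_le_mul_of_nonneg_right (min_le_left δ ε) (sq_nonneg ‖z.1‖)
    have h4 := mul_le_mul_of_nonneg_right (min_le_right δ ε) (sq_nonneg ‖z.2‖)
    have h5 := mul_nonneg hδ.le (sq_nonneg ‖z.1‖)
    have h6 := mul_nonneg hε.le (sq_nonneg ‖z.2‖)
    rw [Prod.norm_def]
    rcases max_choice ‖z.1‖ ‖z.2‖ with h | h <;> rw [h] <;> linarith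
  · have hsymm : B w z = B z w := by
      simp only [hB, hW₁, hW₂, mul_comm (w.1 _ _), mul_comm (w.2 _ _)]
    have := ((hTgen z w).1 hzw).dissipation hd hsupp (fun i => (hrow i).trans hsmall.le) hc hε hgap'
    rw [hsymm, ← two_mul, hB, hW₁, hW₂]
    exact this
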